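/- Let A be a real n×n matrix, let P be a real symmetric invertible n×n matrix having exactly p negative eigenvalues and n−p positive eigenvalues, and suppose there exists ε > 0 such that AᵀP + PA ≼ −εI (i.e., AᵀP + PA + εI is negative semidefinite). Then A has no eigenvalue on the imaginary axis, and, counting algebraic multiplicity, exactly p of the complex eigenvalues of A have positive real part and exactly n−p have negative real part. -/

import Mathlib

open Matrix
open scoped Classical

open Module in
/-- A Hermitian form decreasing along `T` admits an orthogonal basis whose diagonal values have
signs opposite to the real parts of the eigenvalues of `T`, listed with multiplicity. -/
lemma exists_orthogonal_basis_of_lyapunov (d : ℕ) : ∀ {V : Type*} [AddCommGroup V] [Module ℂ V] [FiniteDimensional ℂ V]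
    (_ : finrank ℂ V = d) (B : V →ₗ⋆[ℂ] V →ₗ[ℂ] ℂ) (_ : ∀ x y, star (B x y) = B y x)
    (T : End ℂ V) (_ : ∀ x, x ≠ 0 → (B x (T x)).re < 0),
    ∃ (ι : Type) (_ : Fintype ι) (b : Basis ι ℂ V) (μ : ι → ℂ),
      (∀ i j, i ≠ j → B (b i) (b j) = 0) ∧
      (∀ i, (B (b i) (b i)).re * (μ i).re < 0) ∧
      T.charpoly = ∏ i, (Polynomial.X - Polynomial.C (μ i)) := by
  induction d with
  | zero =>
    intro V _ _ _ hd B hB T hT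
    have b := finBasisOfFinrankEq ℂ V hd
    refine ⟨Fin 0, inferInstance, b, Fin.elim0, fun i => i.elim0, fun i => i.elim0, ?_⟩
    rw [← LinearMap.charpoly_toMatrix T b]
    simp [Matrix.charpoly]
  | succ d ih =>
    intro V _ _ _ hd B hB T hT
    have : Nontrivial V := nontrivial_of_finrank_pos (R := ℂ) (by omega)
    obtain ⟨l, hl⟩ := Module.End.exists_eigenvalue T
    obtain ⟨v, hv⟩ := hl.exists_hasEigenvector
    have hTv : T v = l • v := hv.apply_eq_smul
    have hreal : (B v v).im = 0 := Complex.conj_eq_iff_im.mp (hB v v)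
    have hneg : (B v v).re * l.re < 0 := by
      have := hT v hv.2
      rw [hTv] at this
      simpa [hreal, mul_comm] using this
    have hne : B v v ≠ 0 := by
      intro h
      simp [h] at hneg
    let W := LinearMap.ker (B v)
    let π : V →ₗ[ℂ] W := LinearMap.codRestrict W
      (LinearMap.id - ((B v v)⁻¹ • B v).smulRight v) (by
        intro x
        simp [W]
        field_simp
        simp)
    have hπ (x : V) : (π x : V) = x - ((B v v)⁻¹ * B v x) • v := by simp [π]
    let e : V ≃ₗ[ℂ] ℂ × W := LinearEquiv.ofLinearMap
      (((B v v)⁻¹ • B v).prod π)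
      ((LinearMap.toSpanSingleton ℂ V v).coprod W.subtype)
      (by
        ext x
        · simp [hne]
        · simp [hπ, hne]
        · have := x.2
          simp only [W, LinearMap.mem_ker] at this
          simp [this]
        · have := x.2
          simp only [W, LinearMap.mem_ker] at this
          simp [hπ, this])
      (by
        ext x
        simp [hπ])
    have he1 (x : V) : e x = ((B v v)⁻¹ * B v x, π x) := by simp [e]
    have hes (x : ℂ × W) : e.symm x = x.1 • v + x.2 := by simp [e]
    have hW : finrank ℂ W = d := by
      have := e.finrank_eq
      simp at this
      omega
    let C : End ℂ W := π ∘ₗ T ∘ₗ W.subtype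
    obtain ⟨ι, _, b, μ, hb, hbμ, hC⟩ := ih hW
      ((B.domRestrict W).compl₂ W.subtype) (by intro x y; simpa using hB x y) C (by
        intro x hx
        have h0 : B (x : V) v = 0 := by
          rw [← hB, show B v x = 0 from x.2]; simp
        have := hT x (by simpa using hx)
        simpa [C, hπ, h0] using this)
    let b' : Basis (Unit ⊕ ι) ℂ V := ((Basis.singleton Unit ℂ).prod b).map e.symm
    have hl' (i) : b' (Sum.inl i) = v := by simp [b', hes]
    have hr' (i) : b' (Sum.inr i) = b i := by simp [b', hes]
    have h0 (x : W) : B v x = 0 := x.2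
    have h0' (x : W) : B x v = 0 := by rw [← hB, h0]; simp
    refine ⟨Unit ⊕ ι, inferInstance, b', Sum.elim (fun _ => l) μ, ?_, ?_, ?_⟩
    · rintro (i | i) (j | j) hij
      · exact absurd rfl hij
      · rw [hl', hr', h0]
      · rw [hl', hr', h0']
      · rw [hr', hr']
        exact hb i j (fun h => hij (h ▸ rfl))
    · rintro (i | i)
      · rw [hl']; exact hneg
      · rw [hr']; exact hbμ i
    · have hM : LinearMap.toMatrix b' b' T =
          Matrix.fromBlocks (Matrix.diagonal fun _ => l)
            (Matrix.of fun i j => LinearMap.toMatrix b' b' T (Sum.inl i) (Sum.inr j))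
            0 (LinearMap.toMatrix b b C) := by
        ext (i | i) (j | j)
        · simp only [LinearMap.toMatrix_apply, hl', hTv, Matrix.fromBlocks_apply₁₁]
          simp [b', he1, hne]
        · simp
        · have : π v = 0 := by ext; simp [hπ, hne]
          simp only [LinearMap.toMatrix_apply, hl', hTv, Matrix.fromBlocks_apply₂₁]
          simp [b', he1, this]
        · simp only [LinearMap.toMatrix_apply, hr', Matrix.fromBlocks_apply₂₂]
          simp [b', he1, C]
      rw [← LinearMap.charpoly_toMatrix T b', hM, Matrix.charpoly_fromBlocks_zero₂₁,
        LinearMap.charpoly_toMatrix, hC, Fintype.prod_sum_type]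
      simp [Matrix.charpoly_diagonal]

open Module in
lemma form_re_eq {V ι : Type*} [AddCommGroup V] [Module ℂ V] [Fintype ι]
    (B : V →ₗ⋆[ℂ] V →ₗ[ℂ] ℂ) (b : Basis ι ℂ V) (hb : ∀ i j, i ≠ j → B (b i) (b j) = 0) (x : V) :
    (B x x).re = ∑ i, Complex.normSq (b.repr x i) * (B (b i) (b i)).re := by
  conv_lhs => rw [← b.sum_repr x]
  simp only [map_sum, LinearMap.sum_apply, Complex.re_sum, map_smulₛₗ, LinearMap.smul_apply]
  refine Finset.sum_congr rfl fun i _ => ?_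
  rw [Finset.sum_eq_single i]
  · simp [Complex.normSq_apply]; ring
  · intro j _ hj
    simp [hb j i hj]
  · simp

open Module in
lemma card_neg_le {V ι κ : Type*} [AddCommGroup V] [Module ℂ V] [Fintype ι] [Fintype κ]
    (B : V →ₗ⋆[ℂ] V →ₗ[ℂ] ℂ) (b : Basis ι ℂ V) (c : Basis κ ℂ V)
    (hb : ∀ i j, i ≠ j → B (b i) (b j) = 0) (hc : ∀ i j, i ≠ j → B (c i) (c j) = 0) :
    Fintype.card {i // (B (b i) (b i)).re < 0} ≤ Fintype.card {i // (B (c i) (c i)).re < 0} := by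
  have := Module.Finite.of_basis b
  let S : Set ι := {i | (B (b i) (b i)).re < 0}
  let R : Set κ := {i | ¬ (B (c i) (c i)).re < 0}
  have hS : finrank ℂ (Submodule.span ℂ (b '' S)) = Fintype.card S := by
    rw [Set.image_eq_range]
    exact finrank_span_eq_card (b.linearIndependent.comp _ Subtype.val_injective)
  have hR : finrank ℂ (Submodule.span ℂ (c '' R)) = Fintype.card R := by
    rw [Set.image_eq_range]
    exact finrank_span_eq_card (c.linearIndependent.comp _ Subtype.val_injective)
  have hdis : Disjoint (Submodule.span ℂ (b '' S)) (Submodule.span ℂ (c '' R)) := by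
    rw [Submodule.disjoint_def]
    intro x hxS hxR
    rw [b.mem_span_image] at hxS
    rw [c.mem_span_image] at hxR
    have h1 : 0 ≤ (B x x).re := by
      rw [form_re_eq B c hc]
      refine Finset.sum_nonneg fun i _ => ?_
      by_cases hi : c.repr x i = 0
      · simp [hi]
      · exact mul_nonneg (Complex.normSq_nonneg _) (not_lt.mp (hxR (Finsupp.mem_support_iff.mpr hi)))
    rw [form_re_eq B b hb] at h1
    have h2 : ∀ i ∈ Finset.univ, Complex.normSq (b.repr x i) * (B (b i) (b i)).re ≤ 0 := by
      intro i _
      by_cases hi : b.repr x i = 0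
      · simp [hi]
      · exact mul_nonpos_of_nonneg_of_nonpos (Complex.normSq_nonneg _)
          (hxS (Finsupp.mem_support_iff.mpr hi)).le
    have h3 := (Finset.sum_eq_zero_iff_of_nonpos h2).mp (le_antisymm (Finset.sum_nonpos h2) h1)
    apply b.repr.map_eq_zero_iff.mp
    ext i
    by_contra hi
    have : (B (b i) (b i)).re < 0 := hxS (Finsupp.mem_support_iff.mpr hi)
    rcases mul_eq_zero.mp (h3 i (Finset.mem_univ i)) with h | h
    · exact hi (Complex.normSq_eq_zero.mp h)
    · exact this.ne h
  have h := Submodule.finrank_add_finrank_le_of_disjoint hdis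
  rw [hS, hR, finrank_eq_card_basis c] at h
  have := Fintype.card_subtype_compl (fun i => (B (c i) (c i)).re < 0)
  have h' := Fintype.card_subtype_le (fun i => (B (c i) (c i)).re < 0)
  have e1 : Fintype.card S = Fintype.card {i // (B (b i) (b i)).re < 0} :=
    Fintype.card_congr (Equiv.refl _)
  have e2 : Fintype.card R = Fintype.card {i // ¬ (B (c i) (c i)).re < 0} :=
    Fintype.card_congr (Equiv.refl _)
  omega

open Module in
/-- **Sylvester's law of inertia** for Hermitian forms, negative part. -/
lemma card_neg_eq {V ι κ : Type*} [AddCommGroup V] [Module ℂ V] [Fintype ι] [Fintype κ]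
    (B : V →ₗ⋆[ℂ] V →ₗ[ℂ] ℂ) (b : Basis ι ℂ V) (c : Basis κ ℂ V)
    (hb : ∀ i j, i ≠ j → B (b i) (b j) = 0) (hc : ∀ i j, i ≠ j → B (c i) (c j) = 0) :
    Fintype.card {i // (B (b i) (b i)).re < 0} = Fintype.card {i // (B (c i) (c i)).re < 0} :=
  (card_neg_le B b c hb hc).antisymm (card_neg_le B c b hc hb)

open Module in
/-- **Sylvester's law of inertia** for Hermitian forms, positive part. -/
lemma card_pos_eq {V ι κ : Type*} [AddCommGroup V] [Module ℂ V] [Fintype ι] [Fintype κ]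
    (B : V →ₗ⋆[ℂ] V →ₗ[ℂ] ℂ) (b : Basis ι ℂ V) (c : Basis κ ℂ V)
    (hb : ∀ i j, i ≠ j → B (b i) (b j) = 0) (hc : ∀ i j, i ≠ j → B (c i) (c j) = 0) :
    Fintype.card {i // 0 < (B (b i) (b i)).re} = Fintype.card {i // 0 < (B (c i) (c i)).re} := by
  simpa using card_neg_eq (-B) b c (by simpa using hb) (by simpa using hc)

lemma card_filter_map_univ {ι α : Type*} [Fintype ι] (f : ι → α) (q : α → Prop)
    [DecidablePred q] :
    ((Multiset.map f Finset.univ.val).filter q).card = Fintype.card {i // q (f i)} := by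
  rw [Multiset.filter_map, Multiset.card_map, Fintype.card_subtype]
  rfl

lemma toLinearMapₛₗ₂'_conj_apply {ι : Type*} [Fintype ι] [DecidableEq ι] (H : Matrix ι ι ℂ) (x y : ι → ℂ) :
    Matrix.toLinearMapₛₗ₂' ℂ (starRingEnd ℂ) (RingHom.id ℂ) H x y = star x ⬝ᵥ H *ᵥ y := by
  simp only [Matrix.toLinearMapₛₗ₂'_apply, dotProduct, mulVec, Finset.mul_sum]
  simp [mul_comm]

open Module in
lemma exists_orthogonal_eigenbasis {ι : Type*} [Fintype ι] [DecidableEq ι] {P : Matrix ι ι ℝ}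
    (hP : P.IsSymm) :
    ∃ (c : Basis ι ℂ (ι → ℂ)) (d : ι → ℝ),
      (∀ i j, star (c i) ⬝ᵥ P.map Complex.ofReal *ᵥ c j = if i = j then (d i : ℂ) else 0) ∧
      P.charpoly.roots = Multiset.map d Finset.univ.val := by
  have hH : P.IsHermitian := (conjTranspose_eq_transpose_of_trivial P).trans hP
  have hHC : (P.map Complex.ofReal).IsHermitian := by
    ext i j
    simp [hP.apply]
  refine ⟨hHC.eigenvectorBasis.toBasis.map (WithLp.linearEquiv 2 ℂ (ι → ℂ)), hHC.eigenvalues,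
    ?_, ?_⟩
  · intro i j
    have h := orthonormal_iff_ite.mp hHC.eigenvectorBasis.orthonormal i j
    rw [EuclideanSpace.inner_eq_star_dotProduct, dotProduct_comm] at h
    simp only [Basis.map_apply, OrthonormalBasis.coe_toBasis, WithLp.linearEquiv_apply,
      WithLp.addEquiv_apply, Equiv.toFun_as_coe, AddEquiv.toEquiv_eq_coe, EquivLike.coe_coe,
      hHC.mulVec_eigenvectorBasis, dotProduct_smul, h]
    split_ifs with hij
    · simp [hij]
    · simp
  · apply Multiset.map_injective Complex.ofReal_injective
    rw [Multiset.map_map]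
    refine Eq.trans ?_ hHC.roots_charpoly_eq_eigenvalues
    exact ((congrArg _ (P.charpoly_map Complex.ofRealHom)).trans
      (hH.splits_charpoly.roots_map Complex.ofRealHom)).symm

lemma re_star_dotProduct_map_mulVec {ι : Type*} [Fintype ι] (M : Matrix ι ι ℝ) (x : ι → ℂ) :
    (star x ⬝ᵥ M.map Complex.ofReal *ᵥ x).re =
      (fun i => (x i).re) ⬝ᵥ M *ᵥ (fun i => (x i).re) +
      (fun i => (x i).im) ⬝ᵥ M *ᵥ (fun i => (x i).im) := by
  simp [dotProduct, mulVec, Finset.mul_sum, ← Finset.sum_add_distrib]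

lemma two_mul_dotProduct_mulVec_le_of_lyapunov {ι : Type*} [Fintype ι] [DecidableEq ι] {A P : Matrix ι ι ℝ}
    (hP : P.IsSymm) {ε : ℝ}
    (hLyap : (-(Aᵀ * P + P * A + ε • (1 : Matrix ι ι ℝ))).PosSemidef) (u : ι → ℝ) :
    2 * (u ⬝ᵥ (P * A) *ᵥ u) ≤ -ε * (u ⬝ᵥ u) := by
  have h := hLyap.dotProduct_mulVec_nonneg u
  have ht : u ⬝ᵥ (Aᵀ * P) *ᵥ u = u ⬝ᵥ (P * A) *ᵥ u := by
    have : (Aᵀ * P) = (P * A)ᵀ := by rw [Matrix.transpose_mul, hP.eq]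
    rw [this, mulVec_transpose, dotProduct_comm, ← dotProduct_mulVec]
  simp only [star_trivial, neg_mulVec, add_mulVec, dotProduct_neg, dotProduct_add, ht,
    smul_mulVec, one_mulVec, dotProduct_smul, smul_eq_mul] at h
  linarith

lemma re_form_neg_of_lyapunov {ι : Type*} [Fintype ι] [DecidableEq ι] {A P : Matrix ι ι ℝ}
    (hP : P.IsSymm) {ε : ℝ} (hε : 0 < ε)
    (hLyap : (-(Aᵀ * P + P * A + ε • (1 : Matrix ι ι ℝ))).PosSemidef)
    {x : ι → ℂ} (hx : x ≠ 0) :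
    (star x ⬝ᵥ P.map Complex.ofReal *ᵥ (A.map Complex.ofReal *ᵥ x)).re < 0 := by
  have hmul : P.map Complex.ofReal * A.map Complex.ofReal = (P * A).map Complex.ofReal :=
    (Matrix.map_mul (f := Complex.ofRealHom)).symm
  rw [mulVec_mulVec, hmul, re_star_dotProduct_map_mulVec]
  have h1 := two_mul_dotProduct_mulVec_le_of_lyapunov hP hLyap fun i => (x i).re
  have h2 := two_mul_dotProduct_mulVec_le_of_lyapunov hP hLyap fun i => (x i).im
  have h3 : 0 < (fun i => (x i).re) ⬝ᵥ (fun i => (x i).re) +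
      (fun i => (x i).im) ⬝ᵥ (fun i => (x i).im) := by
    obtain ⟨i, hi⟩ := Function.ne_iff.mp hx
    simp only [dotProduct, ← Finset.sum_add_distrib, ← Complex.normSq_apply]
    exact Finset.sum_pos' (fun i _ => Complex.normSq_nonneg _)
      ⟨i, Finset.mem_univ i, Complex.normSq_pos.mpr hi⟩
  nlinarith

/-- **Inertia of a Lyapunov certificate constrains the spectrum.**
If `P` is a real symmetric invertible matrix with exactly `p` negative and `n - p`
positive eigenvalues, and `AᵀP + PA ≼ -εI` for some `ε > 0`, then `A` has no
eigenvalue on the imaginary axis and, counting algebraic multiplicity, exactly `p`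
complex eigenvalues of `A` have positive real part and `n - p` have negative real part. -/
theorem lyapunov_inertia_spectrum (n p : ℕ) (A P : Matrix (Fin n) (Fin n) ℝ)
    (hPsymm : P.IsSymm) (hPinv : IsUnit P)
    (hPneg : (P.charpoly.roots.filter (fun μ => μ < 0)).card = p)
    (hPpos : (P.charpoly.roots.filter (fun μ => 0 < μ)).card = n - p)
    (ε : ℝ) (hε : 0 < ε)
    (hLyap : (-(Aᵀ * P + P * A + ε • (1 : Matrix (Fin n) (Fin n) ℝ))).PosSemidef) :
    (∀ μ ∈ (A.map (Complex.ofReal)).charpoly.roots, μ.re ≠ 0) ∧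
    ((A.map (Complex.ofReal)).charpoly.roots.filter (fun μ => 0 < μ.re)).card = p ∧
    ((A.map (Complex.ofReal)).charpoly.roots.filter (fun μ => μ.re < 0)).card = n - p := by
  obtain ⟨c, d, hcd, hroots⟩ := exists_orthogonal_eigenbasis hPsymm
  obtain ⟨B, hB⟩ : ∃ B : (Fin n → ℂ) →ₗ⋆[ℂ] (Fin n → ℂ) →ₗ[ℂ] ℂ,
      ∀ x y, B x y = star x ⬝ᵥ P.map Complex.ofReal *ᵥ y :=
    ⟨_, toLinearMapₛₗ₂'_conj_apply (P.map Complex.ofReal)⟩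
  have hherm : ∀ x y, star (B x y) = B y x := by
    intro x y
    have hH : (P.map Complex.ofReal).IsHermitian := by
      ext i j
      simp [hPsymm.apply]
    rw [hB, hB, star_dotProduct, star_star, star_mulVec, hH.eq, dotProduct_mulVec]
  obtain ⟨ι, _, b, μ, hb, hbμ, hchar⟩ := exists_orthogonal_basis_of_lyapunov n (by simp) B hherm
    (A.map Complex.ofReal).toLin' fun x hx => by
      rw [hB, Matrix.toLin'_apply]
      exact re_form_neg_of_lyapunov hPsymm hε hLyap hx
  have hAroots : (A.map Complex.ofReal).charpoly.roots = Multiset.map μ Finset.univ.val := by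
    rw [← Matrix.charpoly_toLin', hchar]
    simpa [Multiset.map_map] using
      Polynomial.roots_multiset_prod_X_sub_C (Multiset.map μ Finset.univ.val)
  have hc : ∀ i j, i ≠ j → B (c i) (c j) = 0 := fun i j hij => by rw [hB, hcd, if_neg hij]
  have hcc : ∀ i, (B (c i) (c i)).re = d i := fun i => by simp [hB, hcd]
  have hneg := card_neg_eq B b c hb hc
  have hpos := card_pos_eq B b c hb hc
  have hsign_neg (i : ι) : (B (b i) (b i)).re < 0 ↔ 0 < (μ i).re := by
    have := hbμ i
    constructor <;> intro h <;> nlinarith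
  have hsign_pos (i : ι) : 0 < (B (b i) (b i)).re ↔ (μ i).re < 0 := by
    have := hbμ i
    constructor <;> intro h <;> nlinarith
  simp only [hcc, hsign_neg, hsign_pos] at hneg hpos
  rw [hroots, card_filter_map_univ] at hPneg hPpos
  rw [hAroots, card_filter_map_univ, card_filter_map_univ]
  refine ⟨?_, hneg.trans hPneg, hpos.trans hPpos⟩
  intro z hz h
  obtain ⟨i, -, rfl⟩ := Multiset.mem_map.mp hz
  have := hbμ i
  simp [h] at this
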